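/- T · A · ᵗT = J, where J is the 2g×2g matrix written in g×g blocks as [[0, I_g], [−I_g, 0]]. (Equivalently, the rows of T define, in terms of the loops c_1, …, c_{2g} with intersection matrix A, a symplectic basis {a_i, b_i} of the first homology of the curve y^{2g+1} = x(1−x).) -/

import Mathlib

open Finset

/-- The sign pairing of a sequence with index `j`, expressed through partial sums. -/
theorem sum_range_mul_sign (u : ℕ → ℤ) (j m : ℕ) (hj : j < m) :
    ∑ i ∈ range m, u i * (if i < j then 1 else if i = j then 0 else -1) =
      ∑ i ∈ range j, u i + ∑ i ∈ range (j + 1), u i - ∑ i ∈ range m, u i := by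
  have key : ∀ m, ∑ i ∈ range m, u i * (if i < j then 1 else if i = j then 0 else -1) =
      if m ≤ j then ∑ i ∈ range m, u i else
        ∑ i ∈ range j, u i + ∑ i ∈ range (j + 1), u i - ∑ i ∈ range m, u i := by
    intro m
    induction m with
    | zero => simp
    | succ m ih =>
      rw [sum_range_succ, ih]
      rcases lt_trichotomy m j with h | rfl | h
      · simp [h, h.le, Nat.succ_le_of_lt h, sum_range_succ]
      · simp
      · rw [if_neg h.not_ge, if_neg h.not_gt, if_neg h.ne', if_neg (by lia), sum_range_succ u m]
        ring
  rw [key, if_neg hj.not_ge]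

theorem sum_range_ite_le_mul (u : ℕ → ℤ) (a m : ℕ) (ha : a ≤ m) :
    ∑ j ∈ range m, (if a ≤ j then 1 else 0) * u j =
      ∑ j ∈ range m, u j - ∑ j ∈ range a, u j := by
  induction m, ha using Nat.le_induction with
  | base =>
    rw [sub_self]
    exact sum_eq_zero fun j hj ↦ by simp [mem_range.mp hj]
  | succ m hm ih =>
    rw [sum_range_succ, ih, if_pos hm, sum_range_succ u m]
    ring

/-- The entries of the transition matrix, as a function of natural number indices. -/
def chordSlideCoeff (g i j : ℕ) : ℤ :=
  if i < g then
    (if j ≤ 2 * i then (-1) ^ j else 0)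
  else
    (if j < 2 * (i - g) then (-1) ^ j else if j = 2 * (i - g) + 1 then 1 else 0)

theorem sum_range_chordSlideCoeff (g i m : ℕ) :
    ∑ j ∈ range m, chordSlideCoeff g i j =
      if i < g then (if m ≤ 2 * i then ((m % 2 : ℕ) : ℤ) else 1)
      else (if m ≤ 2 * (i - g) then ((m % 2 : ℕ) : ℤ) else if m = 2 * (i - g) + 1 then 0 else 1) := by
  induction m with
  | zero => simp
  | succ m ih =>
    rw [sum_range_succ, ih, chordSlideCoeff]
    rcases Nat.even_or_odd m with h | h
    · rw [h.neg_one_pow]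
      have := Nat.even_iff.mp h
      split_ifs <;> lia
    · rw [h.neg_one_pow]
      have := Nat.odd_iff.mp h
      split_ifs <;> lia

theorem sum_chordSlideCoeff_mul_sign (g i j : ℕ) (hi : i < 2 * g) (hj : j < 2 * g) :
    ∑ k ∈ range (2 * g), chordSlideCoeff g i k *
        (if k < j then 1 else if k = j then 0 else -1) =
      if i < g then (if 2 * i + 1 ≤ j then 1 else 0)
      else (if 2 * (i - g) + 2 ≤ j then 1 else 0) - (if 2 * (i - g) = j then 1 else 0) := by
  rw [sum_range_mul_sign _ _ _ hj]
  simp only [sum_range_chordSlideCoeff]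
  split_ifs <;> lia

theorem sum_chordSlideCoeff_pairing (g i k : ℕ) (hi : i < 2 * g) (hk : k < 2 * g) :
    ∑ j ∈ range (2 * g), (if i < g then (if 2 * i + 1 ≤ j then 1 else 0)
      else (if 2 * (i - g) + 2 ≤ j then 1 else 0) - (if 2 * (i - g) = j then 1 else 0)) *
        chordSlideCoeff g k j =
      if i < g ∧ k = i + g then 1 else if k < g ∧ i = k + g then -1 else 0 := by
  by_cases h : i < g
  · simp only [h, if_true]
    rw [sum_range_ite_le_mul _ _ _ (by lia)]
    simp only [sum_range_chordSlideCoeff]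
    split_ifs <;> lia
  · have he : (-1 : ℤ) ^ (2 * (i - g)) = 1 := by simp
    simp only [h, if_false, sub_mul, sum_sub_distrib]
    rw [sum_range_ite_le_mul _ _ _ (by lia)]
    simp only [ite_mul, one_mul, zero_mul, sum_ite_eq, mem_range, sum_range_chordSlideCoeff]
    rw [chordSlideCoeff, he]
    split_ifs <;> lia

/-- `T A ᵗT = J` where `J = [[0, I_g], [-I_g, 0]]`: the rows of `T` give a symplectic
basis of the first homology of the curve `y^{2g+1} = x(1-x)` in terms of the loops
`c₁, …, c_{2g}` with intersection matrix `A` (indices below are 0-based). -/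
theorem chord_slide_symplectic_T (g : ℕ) (hg : 2 ≤ g)
    (A T J : Matrix (Fin (2 * g)) (Fin (2 * g)) ℤ)
    (hA : ∀ i j, A i j = if (i : ℕ) < (j : ℕ) then 1 else if i = j then 0 else -1)
    (hT : ∀ i j, T i j =
      if (i : ℕ) < g then
        (if (j : ℕ) ≤ 2 * (i : ℕ) then (-1) ^ (j : ℕ) else 0)
      else
        (if (j : ℕ) < 2 * ((i : ℕ) - g) then (-1) ^ (j : ℕ)
         else if (j : ℕ) = 2 * ((i : ℕ) - g) + 1 then 1 else 0))
    (hJ : ∀ i j, J i j =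
      if (i : ℕ) < g ∧ (j : ℕ) = (i : ℕ) + g then 1
      else if (j : ℕ) < g ∧ (i : ℕ) = (j : ℕ) + g then -1 else 0) :
    T * A * T.transpose = J := by
  have hT' : ∀ i j, T i j = chordSlideCoeff g i j := hT
  have hTA : ∀ i j, (T * A) i j =
      if (i : ℕ) < g then (if 2 * (i : ℕ) + 1 ≤ j then 1 else 0)
      else (if 2 * ((i : ℕ) - g) + 2 ≤ j then 1 else 0) -
        (if 2 * ((i : ℕ) - g) = j then 1 else 0) := by
    intro i j
    rw [← sum_chordSlideCoeff_mul_sign g i j i.2 j.2, Matrix.mul_apply, ← Fin.sum_univ_eq_sum_range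
      (fun k ↦ chordSlideCoeff g i k * (if k < j then 1 else if k = j then 0 else -1))]
    simp only [hT', hA, Fin.ext_iff]
  ext i k
  rw [hJ, ← sum_chordSlideCoeff_pairing g i k i.2 k.2, Matrix.mul_apply,
    ← Fin.sum_univ_eq_sum_range (fun j ↦ (if (i : ℕ) < g then (if 2 * (i : ℕ) + 1 ≤ j then 1 else 0)
      else (if 2 * ((i : ℕ) - g) + 2 ≤ j then 1 else 0) -
        (if 2 * ((i : ℕ) - g) = j then 1 else 0)) * chordSlideCoeff g k j)]
  simp only [hTA, Matrix.transpose_apply, hT']
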